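/- arXiv:2602.24042 — 8 statements merged into one kernel-verified Lean document; each statement's English description precedes it below -/
import Mathlib

section
/- Let n ≥ 1 and let w : Fin n → ℝ with w_i ≥ 0 and μ : Fin n → ℝ with μ_i > 0 be such that the ratios are sorted non-increasingly: w_1/μ_1 ≥ w_2/μ_2 ≥ … ≥ w_n/μ_n. For t > 0 define the LP value Φ(t) := max { Σ_{i=1}^n x_i w_i : x_i ∈ [0,1] for all i, Σ_{i=1}^n x_i μ_i ≤ t }. Then for every j ∈ {1,…,n}, the prefix J = {1,…,j} satisfies Σ_{i ∈ J} w_i ≥ min{1, (Σ_{i ∈ J} μ_i)/t} · Φ(t). -/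
/-- If `ρ` separates the densities of the items in `J` from those outside `J`, then no fractional
packing of total size at most `∑ i ∈ J, μ i` has larger value than `J`. -/
theorem sum_mul_le_sum_of_density_threshold {ι : Type*} [Fintype ι] (J : Finset ι)
    {w μ y : ι → ℝ} {ρ : ℝ} (hρ : 0 ≤ ρ) (hJ : ∀ i ∈ J, ρ * μ i ≤ w i)
    (hJc : ∀ i ∉ J, w i ≤ ρ * μ i) (hy : ∀ i, y i ∈ Set.Icc (0 : ℝ) 1)
    (hsize : ∑ i, y i * μ i ≤ ∑ i ∈ J, μ i) :
    ∑ i, y i * w i ≤ ∑ i ∈ J, w i := by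
  classical
  have hindicator (f : ι → ℝ) : ∑ i ∈ J, f i = ∑ i, if i ∈ J then f i else 0 := by
    simp
  have hterm : ∑ i, (y i * w i - if i ∈ J then w i else 0) ≤
      ∑ i, ρ * (y i * μ i - if i ∈ J then μ i else 0) := by
    refine Finset.sum_le_sum fun i _ => ?_
    obtain ⟨h0, h1⟩ := hy i
    split_ifs with hi
    · nlinarith [mul_nonneg (sub_nonneg.2 h1) (sub_nonneg.2 (hJ i hi))]
    · nlinarith [mul_nonneg h0 (sub_nonneg.2 (hJc i hi))]
  rw [← Finset.mul_sum, Finset.sum_sub_distrib, Finset.sum_sub_distrib, ← hindicator,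
    ← hindicator] at hterm
  nlinarith [mul_nonneg hρ (sub_nonneg.2 hsize)]

/-- Greedy Block Value Lemma: with items sorted by non-increasing density
`w i / μ i`, every prefix `J = {0, …, j}` satisfies
`∑_{i ∈ J} w i ≥ min{1, (∑_{i ∈ J} μ i) / t} · Φ(t)`, where `Φ(t)` is the
maximum value of the fractional knapsack LP with capacity `t`. -/
theorem stmt_1 (n : ℕ) (hn : 1 ≤ n) (w μ : Fin n → ℝ)
    (hw : ∀ i, 0 ≤ w i) (hμ : ∀ i, 0 < μ i)
    (hsorted : ∀ i j : Fin n, i ≤ j → w j / μ j ≤ w i / μ i)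
    (t : ℝ) (ht : 0 < t) (Φ : ℝ)
    (hΦ : IsGreatest {s : ℝ | ∃ x : Fin n → ℝ,
        (∀ i, x i ∈ Set.Icc (0:ℝ) 1) ∧ (∑ i, x i * μ i) ≤ t ∧
        s = ∑ i, x i * w i} Φ)
    (j : Fin n) :
    min 1 ((∑ i ∈ Finset.Iic j, μ i) / t) * Φ ≤ ∑ i ∈ Finset.Iic j, w i := by
  obtain ⟨⟨x, hx, hxt, rfl⟩, -⟩ := hΦ
  set c := min 1 ((∑ i ∈ Finset.Iic j, μ i) / t)
  have hc0 : 0 ≤ c :=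
    le_min zero_le_one (div_nonneg (Finset.sum_nonneg fun i _ => (hμ i).le) ht.le)
  have hc1 : c ≤ 1 := min_le_left _ _
  have hct : c * t ≤ ∑ i ∈ Finset.Iic j, μ i := (le_div_iff₀ ht).1 (min_le_right _ _)
  have key := sum_mul_le_sum_of_density_threshold (Finset.Iic j) (w := w) (μ := μ)
    (y := fun i => c * x i) (ρ := w j / μ j) (div_nonneg (hw j) (hμ j).le)
    (fun i hi => (le_div_iff₀ (hμ i)).1 (hsorted i j (Finset.mem_Iic.1 hi)))
    (fun i hi => (div_le_iff₀ (hμ i)).1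
      (hsorted j i (not_le.1 (mt Finset.mem_Iic.2 hi)).le))
    (fun i => ⟨mul_nonneg hc0 (hx i).1, mul_le_one₀ hc1 (hx i).1 (hx i).2⟩)
    (by
      simp only [mul_assoc, ← Finset.mul_sum]
      exact (mul_le_mul_of_nonneg_left hxt hc0).trans hct)
  simpa only [mul_assoc, ← Finset.mul_sum] using key
end

section
/- For all real numbers α ∈ [0, 1/2], β ∈ [1/2, 1], and γ ∈ [0, 1], one has max{ α(1−α), (β−γ)(1−α), γ, β(1−β) } ≥ √5 − 2. Moreover, √5 − 2 = φ^{−3}, where φ = (1+√5)/2 is the golden ratio. -/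
/-- The key optimization claim `T ≥ φ⁻³` in the analysis of
Non-Adaptive-Greedy: for all `α ∈ [0,1/2]`, `β ∈ [1/2,1]`, `γ ∈ [0,1]`,
`max{α(1−α), (β−γ)(1−α), γ, β(1−β)} ≥ √5 − 2`, and `√5 − 2 = φ⁻³` for the
golden ratio `φ = (1+√5)/2`. -/
theorem stmt_4 :
    (∀ α β γ : ℝ, α ∈ Set.Icc (0:ℝ) (1/2) → β ∈ Set.Icc (1/2 : ℝ) 1 →
      γ ∈ Set.Icc (0:ℝ) 1 →
      Real.sqrt 5 - 2 ≤
        max (max (α * (1 - α)) ((β - γ) * (1 - α))) (max γ (β * (1 - β)))) ∧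
    Real.sqrt 5 - 2 = (((1 + Real.sqrt 5) / 2) ^ 3)⁻¹ := by
  have hs : Real.sqrt 5 * Real.sqrt 5 = 5 := Real.mul_self_sqrt (by norm_num)
  have hs2 : 2 < Real.sqrt 5 := Real.lt_sqrt_of_sq_lt (by norm_num)
  have hs3 : Real.sqrt 5 < 3 := (Real.sqrt_lt' (by norm_num)).2 (by norm_num)
  generalize Real.sqrt 5 = s at *
  constructor
  · rintro α β γ ⟨-, hα⟩ ⟨hβ, -⟩ -
    by_contra! h
    simp only [max_lt_iff] at h
    obtain ⟨⟨h₁, h₂⟩, h₃, h₄⟩ := h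
    have hα' : α < (3 - s) / 2 := by
      by_contra! hc
      nlinarith [mul_nonneg (sub_nonneg.2 hc) (show 0 ≤ 1 - α - (3 - s) / 2 by linarith)]
    have hβ' : (s - 1) / 2 < β := by
      by_contra! hc
      nlinarith [mul_nonneg (sub_nonneg.2 hc) (show 0 ≤ β - (3 - s) / 2 by linarith)]
    have : (3 - s) / 2 * ((s - 1) / 2) ≤ (β - γ) * (1 - α) :=
      mul_le_mul (by linarith) (by linarith) (by linarith) (by linarith)
    linarith
  · refine eq_inv_of_mul_eq_one_left ?_
    have hcube : ((1 + s) / 2) ^ 3 = s + 2 := by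
      linear_combination (s + 3) / 8 * hs
    rw [hcube]
    linear_combination hs
end

section
/- Let p ∈ [0, 1/2], α ∈ [p, 1/2], β ∈ [1/2, 1], γ ∈ [0, 1/4] be real numbers with 2α < 1 + p, and define h := (1−p)(β−γ) + ((1−p)/2)·( γ − β(β−α)(1−p)/(1+p−2α) ). Then max{ (1−p)α, (1−p)(β−γ), γ, β(1−β), h } ≥ 0.24215. -/
/-- If `x ≥ 1/2` and `x (1 - x)` is below the threshold, then `x` is bounded away from `1/2`. -/
theorem lt_of_mul_one_sub_lt {x : ℝ} (hx : 1 / 2 ≤ x) (h : x * (1 - x) < 0.24215) :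
    0.588 < x := by
  by_contra! hc
  nlinarith [mul_nonneg (sub_nonneg.2 hx) (sub_nonneg.2 hc)]

/-- The bound in the regime where the adaptive value is minimized at the smallest `α`. -/
theorem adaptive_bound_of_add_le_two {q β : ℝ} (hq : 0.588 ≤ q) (hβ : 0.588 ≤ β)
    (hqβ : 2 * β + q ≤ 2) :
    2 * 0.24215 ≤ q * (3 * β - 0.24215 - β ^ 2 - q * β) := by
  have h₁ : 0 ≤ (q - 0.588) * (2 - 2 * β - q) * β :=
    mul_nonneg (mul_nonneg (by linarith) (by linarith)) (by linarith)
  have h₂ : 0 ≤ (β - 0.588) * (0.706 - β) := mul_nonneg (by linarith) (by linarith)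
  have h₃ : 0 ≤ (q - 0.588) * ((β - 0.588) * (0.706 - β)) :=
    mul_nonneg (by linarith) h₂
  nlinarith

/-- A concave quadratic that is nonnegative at both ends of an interval is nonnegative on it. -/
theorem concave_quadratic_nonneg {a b c l r u : ℝ} (ha : 0 ≤ a) (hlu : l ≤ u) (hur : u ≤ r)
    (hl : 0 ≤ -a * l ^ 2 + b * l + c) (hr : 0 ≤ -a * r ^ 2 + b * r + c) :
    0 ≤ -a * u ^ 2 + b * u + c := by
  rcases hlu.eq_or_lt with rfl | hlu'
  · exact hl
  have hlr : 0 < r - l := by linarith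
  refine nonneg_of_mul_nonneg_right (a := r - l) ?_ hlr
  have key : (r - l) * (-a * u ^ 2 + b * u + c) =
      (r - u) * (-a * l ^ 2 + b * l + c) + (u - l) * (-a * r ^ 2 + b * r + c) +
        a * (r - l) * ((u - l) * (r - u)) := by ring
  rw [key]
  have h₁ : 0 ≤ r - u := sub_nonneg.2 hur
  have h₂ : 0 ≤ u - l := sub_nonneg.2 hlu
  positivity

/-- The bound in the regime where the adaptive value is minimized at the largest `α`. -/
theorem adaptive_bound_of_two_le_add {q β : ℝ} (hq : 0.588 ≤ q) (hq1 : q ≤ 1)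
    (hβ : 0.588 ≤ β) (hqβ : 2 ≤ 2 * β + q) (hu : q * β ≤ 0.24215 * (1 + q)) :
    q * (q * β) * (q * β - 0.24215) ≤
      (2 * (q * β) - q * 0.24215 - 2 * 0.24215) * (2 * q - q ^ 2 - 2 * 0.24215) := by
  set D := 2 * q - q ^ 2 - 2 * 0.24215 with hD
  have hD0 : 0 ≤ D := by nlinarith
  have hr : 0 ≤ -q * (0.24215 * (1 + q)) ^ 2 + (2 * D + q * 0.24215) * (0.24215 * (1 + q)) +
      -(q * 0.24215 + 2 * 0.24215) * D := by
    have h₁ : 0 ≤ q * (2 * q - q ^ 2 - 2 * 0.24215 - 0.24215 * q - 0.24215 * q ^ 2) :=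
      mul_nonneg (by linarith) (by nlinarith)
    rw [hD]
    nlinarith
  suffices h : 0 ≤ -q * (q * β) ^ 2 + (2 * D + q * 0.24215) * (q * β) +
      -(q * 0.24215 + 2 * 0.24215) * D by linarith
  rcases le_total q 0.824 with hq' | hq'
  · refine concave_quadratic_nonneg (l := q * (1 - q / 2)) (by linarith)
      (mul_le_mul_of_nonneg_left (by linarith) (by linarith)) hu ?_ hr
    have h₁ := mul_nonneg hD0 (sub_nonneg.2
      (adaptive_bound_of_add_le_two hq (by linarith : 0.588 ≤ 1 - q / 2) (by linarith)))
    rw [hD] at h₁ ⊢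
    linarith
  · refine concave_quadratic_nonneg (l := q * 0.588) (by linarith)
      (mul_le_mul_of_nonneg_left hβ (by linarith)) hu ?_ hr
    rw [hD]
    nlinarith [mul_nonneg (sub_nonneg.2 hq') (sub_nonneg.2 hq1),
      mul_nonneg (mul_nonneg (sub_nonneg.2 hq') (sub_nonneg.2 hq1)) (by linarith : 0 ≤ q)]

/-- The optimization claim `T' ≥ 0.24215` in the analysis of
1-Semi-Adaptive-Greedy for Risky Stochastic Knapsack. -/
theorem stmt_5 (p α β γ : ℝ)
    (hp : p ∈ Set.Icc (0:ℝ) (1/2)) (hα : α ∈ Set.Icc p (1/2 : ℝ))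
    (hβ : β ∈ Set.Icc (1/2 : ℝ) 1) (hγ : γ ∈ Set.Icc (0:ℝ) (1/4))
    (hden : 2 * α < 1 + p)
    (h : ℝ)
    (hh : h = (1 - p) * (β - γ) +
      ((1 - p) / 2) * (γ - β * (β - α) * (1 - p) / (1 + p - 2 * α))) :
    (0.24215 : ℝ) ≤
      max (max ((1 - p) * α) ((1 - p) * (β - γ)))
        (max (max γ (β * (1 - β))) h) := by
  obtain ⟨hp0, hp2⟩ := hp
  obtain ⟨hpα, hα2⟩ := hα
  obtain ⟨hβ2, hβ1⟩ := hβ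
  by_contra! hlt
  simp only [max_lt_iff] at hlt
  obtain ⟨⟨hqα, hqβγ⟩, ⟨hγT, hββ⟩, hhT⟩ := hlt
  obtain ⟨q, rfl⟩ : ∃ q, p = 1 - q := ⟨1 - p, by ring⟩
  simp only [sub_sub_cancel] at *
  have hq2 : 1 / 2 ≤ q := by linarith
  have hq : 0.588 < q := lt_of_mul_one_sub_lt hq2 (by nlinarith)
  have hβ : 0.588 < β := lt_of_mul_one_sub_lt hβ2 hββ
  have hd : 0 < 1 + (1 - q) - 2 * α := by linarith
  have hqγ : q * γ ≤ q * 0.24215 := mul_le_mul_of_nonneg_left hγT.le (by linarith)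
  set X := β * (β - α) * q / (1 + (1 - q) - 2 * α) with hX
  rcases le_total (2 * β + q) 2 with hs | hs
  · have hXle : X ≤ β * (β - 1 + q) := by
      rw [hX, div_le_iff₀ hd]
      nlinarith [mul_nonneg (by linarith : 0 ≤ β)
        (mul_nonneg (sub_nonneg.2 hpα) (sub_nonneg.2 hs))]
    nlinarith [adaptive_bound_of_add_le_two hq.le hβ.le hs,
      mul_le_mul_of_nonneg_left hXle (by linarith : 0 ≤ q)]
  · have hD : 0 < 2 * q - q ^ 2 - 2 * 0.24215 := by nlinarith
    have hXle : X ≤ β * (q * β - 0.24215) * q / (2 * q - q ^ 2 - 2 * 0.24215) := by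
      rw [hX, div_le_div_iff₀ hd hD]
      nlinarith [mul_nonneg (by nlinarith : 0 ≤ β * q)
        (mul_nonneg (sub_nonneg.2 hqα.le) (sub_nonneg.2 hs))]
    have hbound : q * (β * (q * β - 0.24215) * q / (2 * q - q ^ 2 - 2 * 0.24215)) ≤
        2 * (q * β) - q * 0.24215 - 2 * 0.24215 := by
      rw [← mul_div_assoc, div_le_iff₀ hD]
      linarith [adaptive_bound_of_two_le_add hq.le (by linarith) hβ.le hs (by linarith)]
    nlinarith [mul_le_mul_of_nonneg_left hXle (by linarith : 0 ≤ q)]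
end

section
/- Let m ≥ 1, let α_1,…,α_m ∈ [0,1) and p_1,…,p_m ∈ [0,1) be real numbers, and let e_0, e_1, …, e_m be real numbers with e_0 = 0 such that for every i ∈ {1,…,m} there exists a real number y_i with p_i + (1−p_i)·e_i ≤ y_i ≤ α_i + (1−α_i)·e_{i−1}. Then for every i ∈ {0,1,…,m}: 1 − e_i ≥ ∏_{j=1}^{i} (1−α_j)/(1−p_j). -/
/-- Algebraic content of the remaining-capacity lemma for
Semi-Adaptive-Greedy: if `e 0 = 0` and for every `i ∈ {1,…,m}` some real
`y i` satisfies `p i + (1 − p i)·e i ≤ y i ≤ α i + (1 − α i)·e (i−1)`, then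
`1 − e i ≥ ∏_{j=1}^{i} (1 − α j)/(1 − p j)` for every `i ≤ m`. -/
theorem stmt_7 (m : ℕ) (hm : 1 ≤ m) (α p : ℕ → ℝ)
    (hα : ∀ i, 1 ≤ i → i ≤ m → α i ∈ Set.Ico (0:ℝ) 1)
    (hp : ∀ i, 1 ≤ i → i ≤ m → p i ∈ Set.Ico (0:ℝ) 1)
    (e : ℕ → ℝ) (he0 : e 0 = 0)
    (hy : ∀ i, 1 ≤ i → i ≤ m →
      ∃ y : ℝ, p i + (1 - p i) * e i ≤ y ∧ y ≤ α i + (1 - α i) * e (i - 1)) :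
    ∀ i, i ≤ m → ∏ j ∈ Finset.Icc 1 i, (1 - α j) / (1 - p j) ≤ 1 - e i := by
  intro i
  induction i with
  | zero => simp [he0]
  | succ k ih =>
    intro hk
    obtain ⟨y, hy₁, hy₂⟩ := hy (k + 1) (by omega) hk
    have hα₁ := (hα (k + 1) (by omega) hk).2
    have hp₁ := (hp (k + 1) (by omega) hk).2
    rw [Nat.add_sub_cancel] at hy₂
    rw [Finset.prod_Icc_succ_top (by omega), ← mul_div_assoc, div_le_iff₀ (by linarith)]
    have h := mul_le_mul_of_nonneg_right (ih (by omega)) (sub_nonneg.2 hα₁.le)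
    linarith
end

section
/- Let m ≥ 1 and let α_1,…,α_m ∈ [0,1] be real numbers. Then (Σ_{i=1}^m α_i) · ∏_{i=1}^m (1−α_i) ≤ (m/(m+1))^{m+1}, with equality if and only if α_i = 1/(m+1) for every i. -/
/-- The AM-GM inequality for a nonempty finite family of nonnegative reals, in power form,
together with its equality case. -/
theorem prod_le_mean_pow_card_and_eq_iff {ι : Type*} [Fintype ι] [Nonempty ι] (z : ι → ℝ)
    (hz : ∀ i, 0 ≤ z i) :
    ∏ i, z i ≤ ((∑ i, z i) / Fintype.card ι) ^ Fintype.card ι ∧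
    (∏ i, z i = ((∑ i, z i) / Fintype.card ι) ^ Fintype.card ι ↔
      ∀ i, z i = (∑ j, z j) / Fintype.card ι) := by
  set n := Fintype.card ι with hn
  have hn0 : n ≠ 0 := Fintype.card_ne_zero
  have hn_pos : (0 : ℝ) < n := by positivity
  have hw : ∀ i ∈ (Finset.univ : Finset ι), 0 < (fun _ : ι => (n : ℝ)⁻¹) i :=
    fun _ _ => by positivity
  have hw_sum : ∑ i ∈ (Finset.univ : Finset ι), (fun _ : ι => (n : ℝ)⁻¹) i = 1 := by
    simp [← hn, hn_pos.ne']
  have h_prod : ∏ i, z i = (∏ i, z i ^ (n : ℝ)⁻¹) ^ n := by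
    rw [← Finset.prod_pow]
    exact Finset.prod_congr rfl fun i _ => (Real.rpow_inv_natCast_pow (hz i) hn0).symm
  have h_mean : ∑ i, (n : ℝ)⁻¹ * z i = (∑ i, z i) / n := by
    rw [← Finset.mul_sum]; ring
  have h_nonneg : 0 ≤ ∏ i, z i ^ (n : ℝ)⁻¹ :=
    Finset.prod_nonneg fun i _ => Real.rpow_nonneg (hz i) _
  have h_mean_nonneg : 0 ≤ (∑ i, z i) / n :=
    div_nonneg (Finset.sum_nonneg fun i _ => hz i) hn_pos.le
  have h_le := Real.geom_mean_le_arith_mean_weighted Finset.univ _ z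
    (fun i hi => (hw i hi).le) hw_sum (fun i _ => hz i)
  have h_iff := Real.geom_mean_eq_arith_mean_weighted_iff_of_pos' Finset.univ _ z hw hw_sum
    (fun i _ => hz i)
  simp only [h_mean, Finset.mem_univ, true_imp_iff] at h_le h_iff
  rw [h_prod, pow_left_inj₀ h_nonneg h_mean_nonneg hn0]
  exact ⟨pow_le_pow_left₀ h_nonneg h_le n, h_iff⟩

/-- The function `f_m(α) = (∑ α_i)·∏(1−α_i)` on `[0,1]^m` is at most
`(m/(m+1))^(m+1)`, with equality iff all `α_i = 1/(m+1)`. -/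
theorem stmt_8 (m : ℕ) (hm : 1 ≤ m) (α : Fin m → ℝ)
    (hα : ∀ i, α i ∈ Set.Icc (0:ℝ) 1) :
    (∑ i, α i) * ∏ i, (1 - α i) ≤ ((m : ℝ) / (m + 1)) ^ (m + 1) ∧
    ((∑ i, α i) * ∏ i, (1 - α i) = ((m : ℝ) / (m + 1)) ^ (m + 1) ↔
      ∀ i, α i = 1 / (m + 1)) := by
  have hz : ∀ i, 0 ≤ (Fin.cons (∑ i, α i) (fun i => 1 - α i) : Fin (m + 1) → ℝ) i := by
    simp only [Fin.forall_fin_succ, Fin.cons_zero, Fin.cons_succ]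
    exact ⟨Finset.sum_nonneg fun i _ => (hα i).1, fun i => sub_nonneg.2 (hα i).2⟩
  obtain ⟨h_le, h_iff⟩ := prod_le_mean_pow_card_and_eq_iff _ hz
  simp only [Fin.prod_univ_succ, Fin.sum_univ_succ, Fin.forall_fin_succ, Fin.cons_zero,
    Fin.cons_succ, Fintype.card_fin, Finset.sum_sub_distrib, Finset.sum_const,
    Finset.card_univ, nsmul_eq_mul, mul_one, add_sub_cancel, Nat.cast_add, Nat.cast_one]
    at h_le h_iff
  refine ⟨h_le, h_iff.trans ?_⟩
  have h_coord : ∀ i, 1 - α i = (m : ℝ) / (m + 1) ↔ α i = 1 / (m + 1) := fun i => by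
    have h_add : (m : ℝ) / (m + 1) + 1 / (m + 1) = 1 := by field_simp
    constructor <;> intro h <;> linarith
  simp only [h_coord]
  refine ⟨And.right, fun h => ⟨?_, h⟩⟩
  simp [h, div_eq_mul_inv]
end

section
/- For every natural number k ≥ 0, ((k+1)/(k+2))^{k+2} ≥ 1/e − 1/(2e(k+1)), where e is Euler's number. -/
/-- For `1 ≤ t`, `log t ≤ (t - t⁻¹) / 2`. -/
theorem log_le_half_sub_inv {t : ℝ} (ht : 1 ≤ t) : Real.log t ≤ (t - t⁻¹) / 2 := by
  rw [← Real.sinh_log (by linarith)]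
  exact Real.self_le_sinh_iff.mpr (Real.log_nonneg ht)

/-- For every natural `k`, `((k+1)/(k+2))^(k+2) ≥ 1/e − 1/(2e(k+1))`. -/
theorem stmt_10 (k : ℕ) :
    1 / Real.exp 1 - 1 / (2 * Real.exp 1 * (k + 1)) ≤
      (((k : ℝ) + 1) / ((k : ℝ) + 2)) ^ (k + 2) := by
  have hm : (0 : ℝ) < (k : ℝ) + 1 := by positivity
  have hn : (0 : ℝ) < (k : ℝ) + 2 := by positivity
  have hlog : ((k : ℝ) + 2) * Real.log (((k : ℝ) + 2) / (k + 1)) ≤ 1 + 1 / (2 * ((k : ℝ) + 1)) := by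
    have h := log_le_half_sub_inv (t := ((k : ℝ) + 2) / (k + 1))
      ((one_le_div hm).mpr (by linarith))
    calc _ ≤ ((k : ℝ) + 2) * ((((k : ℝ) + 2) / (k + 1) - (((k : ℝ) + 2) / (k + 1))⁻¹) / 2) := by
          gcongr
      _ = 1 + 1 / (2 * ((k : ℝ) + 1)) := by
          field_simp
          ring
  calc 1 / Real.exp 1 - 1 / (2 * Real.exp 1 * (k + 1))
      = Real.exp (-1) * (-(1 / (2 * ((k : ℝ) + 1))) + 1) := by
        rw [Real.exp_neg]
        field_simp
        ring
    _ ≤ Real.exp (-1) * Real.exp (-(1 / (2 * ((k : ℝ) + 1)))) := by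
        gcongr
        exact Real.add_one_le_exp _
    _ = Real.exp (-(1 + 1 / (2 * ((k : ℝ) + 1)))) := by
        rw [← Real.exp_add, neg_add]
    _ ≤ Real.exp (-(((k : ℝ) + 2) * Real.log (((k : ℝ) + 2) / (k + 1)))) := by
        gcongr
    _ = (((k : ℝ) + 1) / ((k : ℝ) + 2)) ^ (k + 2) := by
        rw [← mul_neg, ← Real.log_inv, inv_div]
        have h := Real.exp_nat_mul (Real.log (((k : ℝ) + 1) / (k + 2))) (k + 2)
        rw [Real.exp_log (by positivity)] at h
        exact_mod_cast h
end

section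
/- The supremum, over all p ∈ (0,1), all n ≥ 1, and all finite chains of real numbers p = S_1 ≤ S_2 ≤ … ≤ S_n = 1, of the quantity p · Σ_{i=2}^{n} (S_i − S_{i−1})/S_i, equals 1/e; equivalently, sup_{p ∈ (0,1)} (−p·ln p) = 1/e, attained at p = 1/e. -/
lemma sum_Icc_sub_div_le_log_sub_log (S : ℕ → ℝ) (h1 : 0 < S 1) (n : ℕ) (hn : 1 ≤ n)
    (hS : ∀ i, 1 ≤ i → i < n → S i ≤ S (i + 1)) :
    0 < S n ∧ ∑ i ∈ Finset.Icc 2 n, (S i - S (i - 1)) / S i ≤ Real.log (S n) - Real.log (S 1) := by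
  induction n, hn using Nat.le_induction with
  | base => simpa using h1
  | succ n hn ih =>
    obtain ⟨hpos, hle⟩ := ih fun i hi hin => hS i hi (by omega)
    have hpos' : 0 < S (n + 1) := hpos.trans_le (hS n hn (by omega))
    refine ⟨hpos', ?_⟩
    rw [Finset.sum_Icc_succ_top (by omega), Nat.add_sub_cancel, sub_div, div_self hpos'.ne']
    have hlog := Real.log_le_sub_one_of_pos (div_pos hpos hpos')
    rw [Real.log_div hpos.ne' hpos'.ne'] at hlog
    linarith

lemma neg_mul_log_le_one_div_exp_one {p : ℝ} (hp : 0 < p) :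
    -p * Real.log p ≤ 1 / Real.exp 1 := by
  have he := Real.exp_pos 1
  have hlog := Real.log_le_sub_one_of_pos (inv_pos.mpr (mul_pos hp he))
  rw [Real.log_inv, Real.log_mul hp.ne' he.ne', Real.log_exp] at hlog
  calc -p * Real.log p = p * -Real.log p := by ring
    _ ≤ p * (p * Real.exp 1)⁻¹ := mul_le_mul_of_nonneg_left (by linarith) hp.le
    _ = 1 / Real.exp 1 := by field_simp

lemma neg_mul_log_one_div_exp_one :
    -(1 / Real.exp 1) * Real.log (1 / Real.exp 1) = 1 / Real.exp 1 := by
  simp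

lemma one_div_exp_one_mem_Ioo : 1 / Real.exp 1 ∈ Set.Ioo (0 : ℝ) 1 :=
  ⟨by positivity, (div_lt_one (Real.exp_pos 1)).mpr (Real.one_lt_exp_iff.mpr one_pos)⟩

lemma div_one_add_le_one_sub_exp_neg {x : ℝ} (hx : 0 ≤ x) :
    x / (1 + x) ≤ 1 - Real.exp (-x) := by
  have h : Real.exp (-x) ≤ (1 + x)⁻¹ := by
    rw [Real.exp_neg]
    exact inv_anti₀ (by positivity) (by linarith [Real.add_one_le_exp x])
  calc x / (1 + x) = 1 - (1 + x)⁻¹ := by field_simp; ring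
    _ ≤ 1 - Real.exp (-x) := by linarith

lemma sum_Icc_sub_div_exp_affine (x c : ℝ) (m : ℕ) :
    ∑ i ∈ Finset.Icc 2 (m + 1),
      (Real.exp (i * x + c) - Real.exp ((i - 1 : ℕ) * x + c)) / Real.exp (i * x + c) =
      m * (1 - Real.exp (-x)) := by
  have h : ∀ i ∈ Finset.Icc 2 (m + 1),
      (Real.exp (i * x + c) - Real.exp ((i - 1 : ℕ) * x + c)) / Real.exp (i * x + c) =
      1 - Real.exp (-x) := by
    intro i hi
    rw [Finset.mem_Icc] at hi
    rw [Nat.cast_sub (by omega), sub_div, div_self (Real.exp_pos _).ne', ← Real.exp_sub]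
    congr 2
    push_cast
    ring
  rw [Finset.sum_congr rfl h, Finset.sum_const, Nat.card_Icc, nsmul_eq_mul,
    show m + 1 + 1 - 2 = m by omega]

/-- The supremum over `p ∈ (0,1)` and all chains `p = S 1 ≤ … ≤ S n = 1`
of `p · ∑_{i=2}^{n} (S i − S (i−1))/S i` equals `1/e`; equivalently
`sup_{p ∈ (0,1)} (−p·ln p) = 1/e`, attained at `p = 1/e`. -/
theorem stmt_14 :
    IsLUB {v : ℝ | ∃ p ∈ Set.Ioo (0:ℝ) 1, ∃ n : ℕ, 1 ≤ n ∧ ∃ S : ℕ → ℝ,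
        S 1 = p ∧ S n = 1 ∧ (∀ i, 1 ≤ i → i < n → S i ≤ S (i + 1)) ∧
        v = p * ∑ i ∈ Finset.Icc 2 n, (S i - S (i - 1)) / S i}
      (1 / Real.exp 1) ∧
    IsLUB {v : ℝ | ∃ p ∈ Set.Ioo (0:ℝ) 1, v = -p * Real.log p}
      (1 / Real.exp 1) ∧
    -(1 / Real.exp 1) * Real.log (1 / Real.exp 1) = 1 / Real.exp 1 := by
  refine ⟨⟨?_, ?_⟩, ⟨?_, ?_⟩, neg_mul_log_one_div_exp_one⟩
  · rintro v ⟨p, ⟨hp, -⟩, n, hn, S, rfl, hSn, hS, rfl⟩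
    have hsum := (sum_Icc_sub_div_le_log_sub_log S hp n hn hS).2
    rw [hSn, Real.log_one, zero_sub] at hsum
    calc _ ≤ S 1 * -Real.log (S 1) := mul_le_mul_of_nonneg_left hsum hp.le
      _ = -S 1 * Real.log (S 1) := by ring
      _ ≤ _ := neg_mul_log_le_one_div_exp_one hp
  · intro b hb
    have hlim := (tendsto_natCast_div_add_atTop (1 : ℝ)).const_mul (1 / Real.exp 1)
    rw [mul_one] at hlim
    refine le_of_tendsto hlim ?_
    filter_upwards [Filter.eventually_ge_atTop 1] with m hm
    have hm0 : (0 : ℝ) < m := by exact_mod_cast hm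
    have hx : (0 : ℝ) ≤ 1 / m := by positivity
    refine le_trans ?_ (hb ⟨1 / Real.exp 1, one_div_exp_one_mem_Ioo, m + 1, by omega,
      fun i => Real.exp (i * (1 / m) + (-1 / m - 1)), ?_, ?_, ?_, rfl⟩)
    · rw [sum_Icc_sub_div_exp_affine]
      refine mul_le_mul_of_nonneg_left ?_ (by positivity)
      calc (m : ℝ) / (m + 1) = m * (1 / m / (1 + 1 / m)) := by field_simp
        _ ≤ _ := mul_le_mul_of_nonneg_left (div_one_add_le_one_sub_exp_neg hx) hm0.le
    · rw [one_div (Real.exp 1), ← Real.exp_neg, Real.exp_eq_exp]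
      push_cast
      ring
    · rw [Real.exp_eq_one_iff]
      push_cast
      field_simp
      ring
    · intro i _ _
      refine Real.exp_le_exp.mpr ?_
      push_cast
      linarith
  · rintro v ⟨p, ⟨hp, -⟩, rfl⟩
    exact neg_mul_log_le_one_div_exp_one hp
  · intro b hb
    exact hb ⟨_, one_div_exp_one_mem_Ioo, neg_mul_log_one_div_exp_one.symm⟩
end

section
/- For all real numbers β ∈ [1/2, 3/4] and p ∈ [(4β−2)/(4β−1), 1/2], one has (1−p)·β·(1−β+p) ≥ 1/4. -/
/-- Case d.2 sub-claim: for `β ∈ [1/2, 3/4]` and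
`p ∈ [(4β−2)/(4β−1), 1/2]`, one has `(1−p)·β·(1−β+p) ≥ 1/4`. -/
theorem stmt_17 (β p : ℝ) (hβ : β ∈ Set.Icc (1/2 : ℝ) (3/4 : ℝ))
    (hp₁ : (4 * β - 2) / (4 * β - 1) ≤ p) (hp₂ : p ≤ 1/2) :
    (1/4 : ℝ) ≤ (1 - p) * β * (1 - β + p) := by
  obtain ⟨h₁, h₂⟩ := hβ
  have hβ₀ : 0 ≤ β := by linarith
  have key (q : ℝ) : (1 - p) * β * (1 - β + p) =
      (1 - q) * β * (1 - β + q) + β * ((p - q) * (β - p - q)) := by ring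
  rcases le_total β (p + 1/2) with h | h
  · have hend : (1/4 : ℝ) ≤ (1 - 1/2) * β * (1 - β + 1/2) := by
      nlinarith [mul_nonneg (sub_nonneg.2 h₁) (sub_nonneg.2 h₂)]
    have hdiff : 0 ≤ β * ((p - 1/2) * (β - p - 1/2)) :=
      mul_nonneg hβ₀ (mul_nonneg_of_nonpos_of_nonpos (by linarith) (by linarith))
    linarith [key (1/2)]
  · have hd : 0 < 4 * β - 1 := by linarith
    set q := (4 * β - 2) / (4 * β - 1) with hq
    have hend : (1/4 : ℝ) ≤ (1 - q) * β * (1 - β + q) := by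
      have heq : (1 - q) * β * (1 - β + q) - 1/4 =
          (2 * β - 1) * (1 + 2 * β * (3 - 4 * β)) / (4 * (4 * β - 1) ^ 2) := by
        rw [hq]
        field_simp
        ring
      have hnum : 0 ≤ (2 * β - 1) * (1 + 2 * β * (3 - 4 * β)) := by
        have hβ₁ : 0 ≤ 2 * β - 1 := by linarith
        have hβ₂ : 0 ≤ 3 - 4 * β := by linarith
        positivity
      have : 0 ≤ (1 - q) * β * (1 - β + q) - 1/4 := by
        rw [heq]
        positivity
      linarith
    have hdiff : 0 ≤ β * ((p - q) * (β - p - q)) :=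
      mul_nonneg hβ₀ (mul_nonneg (by linarith) (by linarith))
    linarith [key q]
end
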